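/- For every n ≥ 1 and all σ, σ', λ, λ' > 0, the derivative of the mismatched free energy with respect to the true SNR λ satisfies (d/dλ) f_n = −(1/4)·(1/n²)·√(λ'/λ)·E[⟨(sᵀx)²⟩_{λ',σ'}]. -/

import Mathlib

open MeasureTheory ProbabilityTheory Filter Matrix

noncomputable section

instance {n : ℕ} : MeasurableSpace (Matrix (Fin n) (Fin n) ℝ) :=
  inferInstanceAs (MeasurableSpace (Fin n → Fin n → ℝ))

/-- Squared Frobenius norm of a matrix. -/
def frobSq {n : ℕ} (M : Matrix (Fin n) (Fin n) ℝ) : ℝ := ∑ i, ∑ j, (M i j) ^ 2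

/-- i.i.d. centered Gaussian prior with variance `v` on `ℝⁿ`. -/
def gaussPrior (n : ℕ) (v : ℝ) : Measure (Fin n → ℝ) :=
  Measure.pi fun _ => gaussianReal 0 (Real.toNNReal v)

/-- Law of the symmetric noise matrix `Z`: independent `N(0,1)` entries above the
diagonal and `N(0,2)` entries on the diagonal, extended symmetrically. -/
def noiseMeasure (n : ℕ) : Measure (Matrix (Fin n) (Fin n) ℝ) :=
  (Measure.pi fun p : Fin n × Fin n =>
      gaussianReal 0 (if p.1 = p.2 then 2 else 1)).map
    (fun g => Matrix.of fun i j => if i ≤ j then g (i, j) else g (j, i))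

/-- Observation matrix `Y = √(λ/n) s sᵀ + Z`. -/
def obs (n : ℕ) (lam : ℝ) (s : Fin n → ℝ) (Z : Matrix (Fin n) (Fin n) ℝ) :
    Matrix (Fin n) (Fin n) ℝ :=
  Real.sqrt (lam / n) • Matrix.vecMulVec s s + Z

/-- Posterior weight `exp(−¼‖Y−√(λ'/n) x xᵀ‖_F²)`. -/
def weight (n : ℕ) (lam' : ℝ) (Y : Matrix (Fin n) (Fin n) ℝ) (x : Fin n → ℝ) : ℝ :=
  Real.exp (-(1 / 4) * frobSq (Y - Real.sqrt (lam' / n) • Matrix.vecMulVec x x))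

/-- Gibbs (mismatched posterior) average `⟨f(x)⟩_{λ',σ'}` of an observable `f`. -/
def gibbs (n : ℕ) (sig' lam' : ℝ) (Y : Matrix (Fin n) (Fin n) ℝ)
    (f : (Fin n → ℝ) → ℝ) : ℝ :=
  (∫ x, f x * weight n lam' Y x ∂gaussPrior n (sig' ^ 2)) /
    (∫ x, weight n lam' Y x ∂gaussPrior n (sig' ^ 2))

/-- Posterior mean matrix `⟨x xᵀ⟩_{λ',σ'}`. -/
def gibbsMatrix (n : ℕ) (sig' lam' : ℝ) (Y : Matrix (Fin n) (Fin n) ℝ) :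
    Matrix (Fin n) (Fin n) ℝ :=
  Matrix.of fun i j => gibbs n sig' lam' Y (fun x => x i * x j)

/-- Mismatched matrix-MSE `MSE_n(σ,σ',λ,λ')`. -/
def MSE (n : ℕ) (sig sig' lam lam' : ℝ) : ℝ :=
  (1 / (n : ℝ) ^ 2) *
    ∫ p, frobSq (Matrix.vecMulVec p.1 p.1 -
        gibbsMatrix n sig' lam' (obs n lam p.1 p.2))
      ∂((gaussPrior n (sig ^ 2)).prod (noiseMeasure n))

/-- Partition function `Z(Y)`. -/
def partitionFn (n : ℕ) (sig' lam' : ℝ) (Y : Matrix (Fin n) (Fin n) ℝ) : ℝ :=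
  ∫ x, Real.exp (-(lam' / (4 * n)) * (∑ i, (x i) ^ 2) ^ 2 +
      (1 / 2) * Real.sqrt (lam' / n) * Matrix.trace (Y * Matrix.vecMulVec x x))
    ∂gaussPrior n (sig' ^ 2)

/-- Mismatched free energy `f_n = −(1/n) E[ln Z(Y)]`. -/
def freeEnergy (n : ℕ) (sig sig' lam lam' : ℝ) : ℝ :=
  -(1 / (n : ℝ)) *
    ∫ p, Real.log (partitionFn n sig' lam' (obs n lam p.1 p.2))
      ∂((gaussPrior n (sig ^ 2)).prod (noiseMeasure n))

section aux

def qq {n : ℕ} (x : Fin n → ℝ) : ℝ := ∑ i, (x i) ^ 2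
def yy {n : ℕ} (M : Matrix (Fin n) (Fin n) ℝ) : ℝ := ∑ i, ∑ j, |M i j|
def bb {n : ℕ} (M : Matrix (Fin n) (Fin n) ℝ) (x : Fin n → ℝ) : ℝ :=
  ∑ i, ∑ j, M i j * (x i * x j)
def HH {n : ℕ} (a c : ℝ) (M : Matrix (Fin n) (Fin n) ℝ) (x : Fin n → ℝ) : ℝ :=
  -a * (qq x) ^ 2 + c * bb M x

variable {n : ℕ}

lemma qq_nonneg (x : Fin n → ℝ) : 0 ≤ qq x := Finset.sum_nonneg fun i _ => sq_nonneg _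

lemma yy_nonneg (M : Matrix (Fin n) (Fin n) ℝ) : 0 ≤ yy M :=
  Finset.sum_nonneg fun i _ => Finset.sum_nonneg fun j _ => abs_nonneg _

lemma yy_add_smul_le (τ T : ℝ) (hT : |τ| ≤ T) (D M : Matrix (Fin n) (Fin n) ℝ) :
    yy (τ • D + M) ≤ T * yy D + yy M := by
  unfold yy
  rw [Finset.mul_sum, ← Finset.sum_add_distrib]
  refine Finset.sum_le_sum fun i _ => ?_
  rw [Finset.mul_sum, ← Finset.sum_add_distrib]
  refine Finset.sum_le_sum fun j _ => ?_
  simp only [Matrix.add_apply, Matrix.smul_apply, smul_eq_mul]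
  refine (abs_add_le _ _).trans ?_
  rw [abs_mul]
  gcongr

lemma abs_mul_le_qq (x : Fin n → ℝ) (i j : Fin n) : |x i * x j| ≤ qq x := by
  have hi : (x i) ^ 2 ≤ qq x :=
    Finset.single_le_sum (f := fun i => (x i) ^ 2) (fun i _ => sq_nonneg _) (Finset.mem_univ i)
  have hj : (x j) ^ 2 ≤ qq x :=
    Finset.single_le_sum (f := fun i => (x i) ^ 2) (fun i _ => sq_nonneg _) (Finset.mem_univ j)
  rw [abs_le]
  constructor <;> nlinarith [sq_nonneg (x i + x j), sq_nonneg (x i - x j)]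

lemma abs_bb_le (M : Matrix (Fin n) (Fin n) ℝ) (x : Fin n → ℝ) : |bb M x| ≤ yy M * qq x := by
  unfold bb yy
  rw [Finset.sum_mul]
  refine (Finset.abs_sum_le_sum_abs _ _).trans (Finset.sum_le_sum fun i _ => ?_)
  rw [Finset.sum_mul]
  refine (Finset.abs_sum_le_sum_abs _ _).trans (Finset.sum_le_sum fun j _ => ?_)
  rw [abs_mul]
  exact mul_le_mul_of_nonneg_left (abs_mul_le_qq x i j) (abs_nonneg _)

lemma bb_add_smul (τ : ℝ) (D M : Matrix (Fin n) (Fin n) ℝ) (x : Fin n → ℝ) :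
    bb (τ • D + M) x = τ * bb D x + bb M x := by
  unfold bb
  rw [Finset.mul_sum, ← Finset.sum_add_distrib]
  refine Finset.sum_congr rfl fun i _ => ?_
  rw [Finset.mul_sum, ← Finset.sum_add_distrib]
  refine Finset.sum_congr rfl fun j _ => ?_
  simp only [Matrix.add_apply, Matrix.smul_apply, smul_eq_mul]
  ring

lemma bb_vecMulVec (s x : Fin n → ℝ) : bb (vecMulVec s s) x = (∑ i, s i * x i) ^ 2 := by
  unfold bb
  rw [sq, Finset.sum_mul_sum]
  refine Finset.sum_congr rfl fun i _ => Finset.sum_congr rfl fun j _ => ?_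
  simp only [vecMulVec_apply]
  ring

lemma HH_le {a c : ℝ} (hc : 0 ≤ c) {y : ℝ} (M : Matrix (Fin n) (Fin n) ℝ) (hy : yy M ≤ y)
    (x : Fin n → ℝ) : HH a c M x ≤ -a * (qq x) ^ 2 + c * y * qq x := by
  unfold HH
  have h1 := (le_abs_self _).trans (abs_bb_le M x)
  have h2 := mul_le_mul_of_nonneg_right hy (qq_nonneg x)
  have h3 := mul_le_mul_of_nonneg_left (h1.trans h2) hc
  linarith

lemma le_HH {a c : ℝ} (hc : 0 ≤ c) (M : Matrix (Fin n) (Fin n) ℝ)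
    (x : Fin n → ℝ) : -a * (qq x) ^ 2 - c * yy M * qq x ≤ HH a c M x := by
  unfold HH
  have h1 := (neg_le_abs _).trans (abs_bb_le M x)
  have h3 := mul_le_mul_of_nonneg_left h1 hc
  linarith

lemma quad_le {a : ℝ} (ha : 0 < a) (h q : ℝ) : -a * q ^ 2 + h * q ≤ h ^ 2 / (4 * a) := by
  rw [le_div_iff₀ (by positivity)]
  nlinarith [sq_nonneg (2 * a * q - h)]

lemma exp_HH_le {a c : ℝ} (ha : 0 < a) (hc : 0 ≤ c) (M : Matrix (Fin n) (Fin n) ℝ)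
    (x : Fin n → ℝ) : Real.exp (HH a c M x) ≤ Real.exp ((c * yy M) ^ 2 / (4 * a)) :=
  Real.exp_le_exp.2 ((HH_le hc M le_rfl x).trans (quad_le ha _ _))

lemma qq_exp_HH_le {a c : ℝ} (ha : 0 < a) (hc : 0 ≤ c) {y : ℝ} (M : Matrix (Fin n) (Fin n) ℝ)
    (hy : yy M ≤ y) (x : Fin n → ℝ) :
    qq x * Real.exp (HH a c M x) ≤ Real.exp ((c * y + 1) ^ 2 / (4 * a)) := by
  have h1 : qq x ≤ Real.exp (qq x) := by linarith [Real.add_one_le_exp (qq x)]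
  calc qq x * Real.exp (HH a c M x) ≤ Real.exp (qq x) * Real.exp (HH a c M x) := by gcongr
    _ = Real.exp (qq x + HH a c M x) := (Real.exp_add _ _).symm
    _ ≤ _ := Real.exp_le_exp.2 (by
      have := HH_le (a := a) hc M hy x
      have := quad_le ha (c * y + 1) (qq x)
      linarith)

lemma measurable_entry (i j : Fin n) : Measurable fun M : Matrix (Fin n) (Fin n) ℝ => M i j :=
  (measurable_pi_apply j).comp (measurable_pi_apply (X := fun _ : Fin n => Fin n → ℝ) i)

lemma measurable_qq : Measurable (qq : (Fin n → ℝ) → ℝ) := by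
  unfold qq; fun_prop

lemma measurable_bb (M : Matrix (Fin n) (Fin n) ℝ) : Measurable (bb M) := by
  unfold bb; fun_prop

lemma measurable_HH (a c : ℝ) (M : Matrix (Fin n) (Fin n) ℝ) : Measurable (HH a c M) := by
  unfold HH
  have := measurable_bb M
  have := measurable_qq (n := n)
  fun_prop

variable (P : Measure (Fin n → ℝ)) [IsProbabilityMeasure P]

lemma integrable_exp_HH {a c : ℝ} (ha : 0 < a) (hc : 0 ≤ c) (M : Matrix (Fin n) (Fin n) ℝ) :
    Integrable (fun x => Real.exp (HH a c M x)) P := by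
  refine Integrable.mono' (integrable_const (Real.exp ((c * yy M) ^ 2 / (4 * a))))
    (measurable_HH a c M).exp.aestronglyMeasurable (ae_of_all _ fun x => ?_)
  rw [Real.norm_eq_abs, abs_of_pos (Real.exp_pos _)]
  exact exp_HH_le ha hc M x

lemma integrable_qq_exp_HH {a c : ℝ} (ha : 0 < a) (hc : 0 ≤ c) (M : Matrix (Fin n) (Fin n) ℝ) :
    Integrable (fun x => qq x * Real.exp (HH a c M x)) P := by
  refine Integrable.mono' (integrable_const (Real.exp ((c * yy M + 1) ^ 2 / (4 * a))))
    (measurable_qq.mul (measurable_HH a c M).exp).aestronglyMeasurable (ae_of_all _ fun x => ?_)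
  rw [Real.norm_eq_abs, abs_of_nonneg (mul_nonneg (qq_nonneg x) (Real.exp_pos _).le)]
  exact qq_exp_HH_le ha hc M le_rfl x

lemma Z_upper {a c : ℝ} (ha : 0 < a) (hc : 0 ≤ c) (M : Matrix (Fin n) (Fin n) ℝ) :
    ∫ x, Real.exp (HH a c M x) ∂P ≤ Real.exp ((c * yy M) ^ 2 / (4 * a)) := by
  have := integral_mono (integrable_exp_HH P ha hc M) (integrable_const _)
    (fun x => exp_HH_le ha hc M x)
  simpa using this

lemma Z_lower {a c : ℝ} (ha : 0 < a) (hc : 0 ≤ c) (hP : MemLp qq 2 P)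
    (M : Matrix (Fin n) (Fin n) ℝ) :
    Real.exp (-(a * ∫ x, (qq x) ^ 2 ∂P) - c * yy M * ∫ x, qq x ∂P) ≤
      ∫ x, Real.exp (HH a c M x) ∂P := by
  have h1 : Integrable qq P := hP.integrable (by norm_num)
  have h2 : Integrable (fun x => (qq x) ^ 2) P := hP.integrable_sq
  set m : ℝ := -(a * ∫ x, (qq x) ^ 2 ∂P) - c * yy M * ∫ x, qq x ∂P with hm
  have hi : Integrable (fun x => -a * (qq x) ^ 2 - c * yy M * qq x) P :=
    (h2.const_mul _).sub (h1.const_mul _)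
  have hI : ∫ x, (-a * (qq x) ^ 2 - c * yy M * qq x) ∂P = m := by
    rw [integral_sub (h2.const_mul _) (h1.const_mul _), integral_const_mul, integral_const_mul, hm]
    ring
  have hint : ∫ x, Real.exp m * (1 + ((-a * (qq x) ^ 2 - c * yy M * qq x) - m)) ∂P
      = Real.exp m := by
    rw [integral_const_mul, integral_add (integrable_const _) (show Integrable
      (fun x => (-a * (qq x) ^ 2 - c * yy M * qq x) - m) P from hi.sub (integrable_const _)),
      integral_sub hi (integrable_const _), hI]
    simp
  rw [← hint]
  refine integral_mono (((integrable_const _).add (hi.sub (integrable_const _))).const_mul _)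
    (integrable_exp_HH P ha hc M) fun x => ?_
  have h3 := le_HH (a := a) hc M x
  have h4 := Real.add_one_le_exp ((-a * (qq x) ^ 2 - c * yy M * qq x) - m)
  calc Real.exp m * (1 + ((-a * (qq x) ^ 2 - c * yy M * qq x) - m))
      ≤ Real.exp m * Real.exp ((-a * (qq x) ^ 2 - c * yy M * qq x) - m) := by
        gcongr; linarith
    _ = Real.exp (-a * (qq x) ^ 2 - c * yy M * qq x) := by rw [← Real.exp_add]; congr 1; ring
    _ ≤ _ := Real.exp_le_exp.2 h3

lemma Z_pos {a c : ℝ} (ha : 0 < a) (hc : 0 ≤ c) (hP : MemLp qq 2 P)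
    (M : Matrix (Fin n) (Fin n) ℝ) : 0 < ∫ x, Real.exp (HH a c M x) ∂P :=
  (Real.exp_pos _).trans_le (Z_lower P ha hc hP M)

lemma ratio_le {a c : ℝ} (ha : 0 < a) (hc : 0 ≤ c) (hP : MemLp qq 2 P)
    (M : Matrix (Fin n) (Fin n) ℝ) (y : ℝ) (hy : yy M ≤ y) :
    ∫ x, qq x * Real.exp (HH a c M x) ∂P ≤
      ((c * y + 1) / a + 2 * (a * (∫ x, (qq x) ^ 2 ∂P) + c * y * ∫ x, qq x ∂P) + 1) *
        ∫ x, Real.exp (HH a c M x) ∂P := by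
  set A := ∫ x, (qq x) ^ 2 ∂P with hA
  set B := ∫ x, qq x ∂P with hB
  have hA0 : 0 ≤ A := integral_nonneg fun x => sq_nonneg _
  have hB0 : 0 ≤ B := integral_nonneg fun x => qq_nonneg _
  have hy0 : 0 ≤ y := (yy_nonneg M).trans hy
  have hcy : 0 ≤ c * y := mul_nonneg hc hy0
  set L := a * A + c * y * B with hL
  have hL0 : 0 ≤ L := by positivity
  set K := (c * y + 1) / a + 2 * L with hK
  have hK0 : 0 ≤ K := by positivity
  have hZ : Real.exp (-L) ≤ ∫ x, Real.exp (HH a c M x) ∂P := by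
    refine le_trans (Real.exp_le_exp.2 ?_) (Z_lower P ha hc hP M)
    have : c * yy M * B ≤ c * y * B := by gcongr
    rw [← hA, ← hB]
    linarith
  have hpt : ∀ x : Fin n → ℝ, qq x * Real.exp (HH a c M x) ≤
      K * Real.exp (HH a c M x) + Real.exp (-L) := by
    intro x
    rcases le_total (qq x) K with h | h
    · have := mul_le_mul_of_nonneg_right h (Real.exp_pos (HH a c M x)).le
      have := Real.exp_pos (-L)
      linarith
    · have hq := qq_nonneg x
      have h1 := HH_le (a := a) hc M hy x
      have h2 : c * y + 1 ≤ a * qq x := by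
        have : (c * y + 1) / a ≤ qq x := by linarith
        rw [div_le_iff₀ ha] at this
        linarith
      have h3 : HH a c M x ≤ - qq x := by nlinarith
      have h4 : 2 * L ≤ qq x := by
        have : 0 ≤ (c * y + 1) / a := by positivity
        linarith
      have h5 : qq x ≤ Real.exp (qq x / 2) := by
        have h6 := Real.quadratic_le_exp_of_nonneg (x := qq x / 2) (by positivity)
        nlinarith [sq_nonneg (qq x / 2 - 1)]
      have h7 : qq x * Real.exp (HH a c M x) ≤ Real.exp (-L) := by
        calc qq x * Real.exp (HH a c M x) ≤ Real.exp (qq x / 2) * Real.exp (HH a c M x) := by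
              gcongr
          _ = Real.exp (qq x / 2 + HH a c M x) := (Real.exp_add _ _).symm
          _ ≤ _ := Real.exp_le_exp.2 (by linarith)
      have := mul_nonneg hK0 (Real.exp_pos (HH a c M x)).le
      linarith
  have hmono := integral_mono (integrable_qq_exp_HH P ha hc M)
    (((integrable_exp_HH P ha hc M).const_mul K).add (integrable_const _)) hpt
  have he : ∫ x, (K * Real.exp (HH a c M x) + Real.exp (-L)) ∂P =
      K * (∫ x, Real.exp (HH a c M x) ∂P) + Real.exp (-L) := by
    rw [integral_add ((integrable_exp_HH P ha hc M).const_mul K) (integrable_const _),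
      integral_const_mul]
    simp
  have hmono' : ∫ x, qq x * Real.exp (HH a c M x) ∂P ≤
      K * (∫ x, Real.exp (HH a c M x) ∂P) + Real.exp (-L) := he ▸ hmono
  linarith

lemma hasDerivAt_Z {a c : ℝ} (ha : 0 < a) (hc : 0 ≤ c) (D M : Matrix (Fin n) (Fin n) ℝ) (τ : ℝ) :
    HasDerivAt (fun t => ∫ x, Real.exp (HH a c (t • D + M) x) ∂P)
      (∫ x, c * bb D x * Real.exp (HH a c (τ • D + M) x) ∂P) τ := by
  refine (hasDerivAt_integral_of_dominated_loc_of_deriv_le (μ := P)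
    (F := fun t x => Real.exp (HH a c (t • D + M) x))
    (F' := fun t x => c * bb D x * Real.exp (HH a c (t • D + M) x))
    (s := Metric.ball τ 1) (Metric.ball_mem_nhds _ one_pos)
    (bound := fun _ => c * yy D *
      Real.exp ((c * ((|τ| + 1) * yy D + yy M) + 1) ^ 2 / (4 * a)))
    (Eventually.of_forall fun t => (measurable_HH _ _ _).exp.aestronglyMeasurable)
    (integrable_exp_HH P ha hc _)
    (((measurable_bb D).const_mul c).mul (measurable_HH _ _ _).exp).aestronglyMeasurable
    (ae_of_all _ fun x t ht => ?_) (integrable_const _) (ae_of_all _ fun x t _ => ?_)).2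
  · have ht' : |t| ≤ |τ| + 1 := by
      rw [Metric.mem_ball, Real.dist_eq] at ht
      have := abs_sub_abs_le_abs_sub t τ
      linarith
    rw [Real.norm_eq_abs, abs_mul, abs_mul, abs_of_nonneg hc, abs_of_pos (Real.exp_pos _)]
    have h1 := qq_exp_HH_le ha hc (t • D + M) (yy_add_smul_le t _ ht' D M) x
    calc c * |bb D x| * Real.exp (HH a c (t • D + M) x)
        ≤ c * (yy D * qq x) * Real.exp (HH a c (t • D + M) x) := by
          gcongr; exact abs_bb_le D x
      _ = c * yy D * (qq x * Real.exp (HH a c (t • D + M) x)) := by ring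
      _ ≤ _ := mul_le_mul_of_nonneg_left h1 (mul_nonneg hc (yy_nonneg D))
  · have h : HasDerivAt (fun t => HH a c (t • D + M) x) (c * bb D x) t := by
      have : (fun t => HH a c (t • D + M) x) =
          fun t => -a * (qq x) ^ 2 + c * (t * bb D x + bb M x) := by
        funext t; unfold HH; rw [bb_add_smul]
      rw [this]
      have := ((((hasDerivAt_id t).mul_const (bb D x)).add_const (bb M x)).const_mul c).const_add
        (-a * (qq x) ^ 2)
      simpa using this
    have := h.exp
    rwa [mul_comm] at this

lemma abs_deriv_num_le {a c : ℝ} (ha : 0 < a) (hc : 0 ≤ c) (D M : Matrix (Fin n) (Fin n) ℝ) :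
    |∫ x, c * bb D x * Real.exp (HH a c M x) ∂P| ≤
      c * yy D * ∫ x, qq x * Real.exp (HH a c M x) ∂P := by
  rw [← integral_const_mul, ← Real.norm_eq_abs]
  refine norm_integral_le_of_norm_le ((integrable_qq_exp_HH P ha hc M).const_mul _)
    (ae_of_all _ fun x => ?_)
  rw [Real.norm_eq_abs, abs_mul, abs_mul, abs_of_nonneg hc, abs_of_pos (Real.exp_pos _)]
  calc c * |bb D x| * Real.exp (HH a c M x)
      ≤ c * (yy D * qq x) * Real.exp (HH a c M x) := by gcongr; exact abs_bb_le D x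
    _ = _ := by ring

lemma abs_log_Z_le {a c : ℝ} (ha : 0 < a) (hc : 0 ≤ c) (hP : MemLp qq 2 P)
    (M : Matrix (Fin n) (Fin n) ℝ) (y : ℝ) (hy : yy M ≤ y) :
    |Real.log (∫ x, Real.exp (HH a c M x) ∂P)| ≤
      (c * y) ^ 2 / (4 * a) + (a * (∫ x, (qq x) ^ 2 ∂P) + c * y * ∫ x, qq x ∂P) := by
  have hZ := Z_pos P ha hc hP M
  have h1 := (Real.log_le_iff_le_exp hZ).2 (Z_upper P ha hc M)
  have h2 := (Real.le_log_iff_exp_le hZ).2 (Z_lower P ha hc hP M)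
  have hA0 : 0 ≤ ∫ x, (qq x) ^ 2 ∂P := integral_nonneg fun x => sq_nonneg _
  have hB0 : 0 ≤ ∫ x, qq x ∂P := integral_nonneg fun x => qq_nonneg _
  have hM := yy_nonneg M
  have hy0 : 0 ≤ y := hM.trans hy
  have h3 : (c * yy M) ^ 2 / (4 * a) ≤ (c * y) ^ 2 / (4 * a) := by gcongr
  have h4 : c * yy M * ∫ x, qq x ∂P ≤ c * y * ∫ x, qq x ∂P := by gcongr
  have h5 : 0 ≤ a * (∫ x, (qq x) ^ 2 ∂P) := by positivity
  have h6 : 0 ≤ c * y * (∫ x, qq x ∂P) := by positivity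
  have h7 : 0 ≤ (c * y) ^ 2 / (4 * a) := by positivity
  rw [abs_le]
  constructor <;> linarith

/-- Outer differentiation, for an arbitrary law `Q` of the pair (spike, noise). -/
lemma hasDerivAt_logZ {a c : ℝ} (ha : 0 < a) (hc : 0 ≤ c) (hP : MemLp qq 2 P)
    (Q : Measure ((Fin n → ℝ) × Matrix (Fin n) (Fin n) ℝ)) [IsProbabilityMeasure Q]
    (hd : MemLp (fun p : (Fin n → ℝ) × Matrix (Fin n) (Fin n) ℝ => yy (vecMulVec p.1 p.1)) 2 Q)
    (hz : MemLp (fun p : (Fin n → ℝ) × Matrix (Fin n) (Fin n) ℝ => yy p.2) 2 Q) (τ : ℝ) :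
    HasDerivAt (fun t => ∫ p, Real.log
        (∫ x, Real.exp (HH a c (t • vecMulVec p.1 p.1 + p.2) x) ∂P) ∂Q)
      (∫ p, (∫ x, c * bb (vecMulVec p.1 p.1) x *
          Real.exp (HH a c (τ • vecMulVec p.1 p.1 + p.2) x) ∂P) /
        (∫ x, Real.exp (HH a c (τ • vecMulVec p.1 p.1 + p.2) x) ∂P) ∂Q) τ := by
  have hme := fun i j => measurable_entry (n := n) i j
  have hm1 : ∀ t : ℝ, Measurable fun z : ((Fin n → ℝ) × Matrix (Fin n) (Fin n) ℝ) × (Fin n → ℝ) =>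
      Real.exp (HH a c (t • vecMulVec z.1.1 z.1.1 + z.1.2) z.2) := by
    intro t
    unfold HH qq bb
    simp only [Matrix.add_apply, Matrix.smul_apply, vecMulVec_apply, smul_eq_mul]
    have h0 : ∀ i j, Measurable fun z : ((Fin n → ℝ) × Matrix (Fin n) (Fin n) ℝ) × (Fin n → ℝ) =>
      z.1.2 i j := fun i j => (hme i j).comp (measurable_snd.comp measurable_fst)
    fun_prop
  have hm2 : Measurable fun z : ((Fin n → ℝ) × Matrix (Fin n) (Fin n) ℝ) × (Fin n → ℝ) =>
      bb (vecMulVec z.1.1 z.1.1) z.2 := by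
    unfold bb
    simp only [vecMulVec_apply]
    fun_prop
  have hM1 : ∀ t : ℝ, StronglyMeasurable fun p : (Fin n → ℝ) × Matrix (Fin n) (Fin n) ℝ =>
      ∫ x, Real.exp (HH a c (t • vecMulVec p.1 p.1 + p.2) x) ∂P := fun t =>
    (hm1 t).stronglyMeasurable.integral_prod_right'
  have hM2 : StronglyMeasurable fun p : (Fin n → ℝ) × Matrix (Fin n) (Fin n) ℝ =>
      ∫ x, c * bb (vecMulVec p.1 p.1) x *
          Real.exp (HH a c (τ • vecMulVec p.1 p.1 + p.2) x) ∂P :=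
    ((hm2.const_mul c).mul (hm1 τ)).stronglyMeasurable.integral_prod_right'
  set A := ∫ x, (qq x) ^ 2 ∂P with hA
  set B := ∫ x, qq x ∂P with hB
  set T := |τ| + 1 with hT
  let Yb : (Fin n → ℝ) × Matrix (Fin n) (Fin n) ℝ → ℝ :=
    fun p => T * yy (vecMulVec p.1 p.1) + yy p.2
  have hY : MemLp Yb 2 Q := (hd.const_mul T).add hz
  have hYi : Integrable Yb Q := hY.integrable (by norm_num)
  have hYsq : Integrable (fun p => (Yb p) ^ 2) Q := hY.integrable_sq
  have hdi : Integrable (fun p : (Fin n → ℝ) × Matrix (Fin n) (Fin n) ℝ =>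
    yy (vecMulVec p.1 p.1)) Q := hd.integrable (by norm_num)
  have hdY : Integrable (fun p => yy (vecMulVec p.1 p.1) * Yb p) Q := hd.integrable_mul hY
  refine (hasDerivAt_integral_of_dominated_loc_of_deriv_le (μ := Q)
    (F := fun t p => Real.log (∫ x, Real.exp (HH a c (t • vecMulVec p.1 p.1 + p.2) x) ∂P))
    (F' := fun t p => (∫ x, c * bb (vecMulVec p.1 p.1) x *
          Real.exp (HH a c (t • vecMulVec p.1 p.1 + p.2) x) ∂P) /
        (∫ x, Real.exp (HH a c (t • vecMulVec p.1 p.1 + p.2) x) ∂P))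
    (s := Metric.ball τ 1) (Metric.ball_mem_nhds _ one_pos)
    (bound := fun p => c * yy (vecMulVec p.1 p.1) *
      ((c * Yb p + 1) / a + 2 * (a * A + c * Yb p * B) + 1))
    (Eventually.of_forall fun t => (hM1 t).measurable.log.aestronglyMeasurable)
    ?_ (hM2.measurable.div (hM1 τ).measurable).aestronglyMeasurable
    (ae_of_all _ fun p t ht => ?_) ?_ (ae_of_all _ fun p t _ => ?_)).2
  · refine Integrable.mono' (g := fun p => (c * Yb p) ^ 2 / (4 * a) + (a * A + c * Yb p * B)) ?_
      (hM1 τ).measurable.log.aestronglyMeasurable (ae_of_all _ fun p => ?_)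
    · have := (hYsq.const_mul (c ^ 2 / (4 * a))).add
        ((integrable_const (a * A)).add (hYi.const_mul (c * B)))
      refine this.congr (ae_of_all _ fun p => ?_)
      simp only [Pi.add_apply]
      ring
    · exact abs_log_Z_le P ha hc hP _ _ (yy_add_smul_le τ T (by linarith) _ _)
  · have ht' : |t| ≤ T := by
      rw [Metric.mem_ball, Real.dist_eq] at ht
      have := abs_sub_abs_le_abs_sub t τ
      linarith
    have hZ := Z_pos P ha hc hP (t • vecMulVec p.1 p.1 + p.2)
    rw [Real.norm_eq_abs, abs_div, abs_of_pos hZ, div_le_iff₀ hZ]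
    refine (abs_deriv_num_le P ha hc _ _).trans ?_
    rw [mul_assoc (c * yy _)]
    exact mul_le_mul_of_nonneg_left
      (ratio_le P ha hc hP _ _ (yy_add_smul_le t T ht' _ _)) (mul_nonneg hc (yy_nonneg _))
  · have := (hdi.const_mul (c * (1 / a + 2 * (a * A) + 1))).add
      (hdY.const_mul (c * (c / a + 2 * (c * B))))
    refine this.congr (ae_of_all _ fun p => ?_)
    simp only [Pi.add_apply]
    ring
  · exact (hasDerivAt_Z P ha hc _ _ t).log (Z_pos P ha hc hP _).ne'

instance (v : ℝ) : IsProbabilityMeasure (gaussPrior n v) := by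
  unfold gaussPrior; infer_instance

lemma measurable_symm : Measurable (fun g : Fin n × Fin n → ℝ =>
    (Matrix.of fun i j => if i ≤ j then g (i, j) else g (j, i) : Matrix (Fin n) (Fin n) ℝ)) := by
  refine measurable_pi_lambda (X := fun _ : Fin n => Fin n → ℝ) _ fun i => ?_
  refine measurable_pi_lambda _ fun j => ?_
  simp only [Matrix.of_apply]
  split_ifs <;> fun_prop

instance : IsProbabilityMeasure (noiseMeasure n) := by
  unfold noiseMeasure
  exact Measure.isProbabilityMeasure_map measurable_symm.aemeasurable

lemma memLp_coord (v : ℝ) (i : Fin n) : MemLp (fun s : Fin n → ℝ => s i) 4 (gaussPrior n v) :=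
  (memLp_id_gaussianReal' 4 (by norm_num)).comp_measurePreserving
    (measurePreserving_eval (fun _ : Fin n => gaussianReal 0 (Real.toNNReal v)) i)

lemma memLp_coord_mul (v : ℝ) (i j : Fin n) :
    MemLp (fun s : Fin n → ℝ => s i * s j) 2 (gaussPrior n v) := by
  haveI : ENNReal.HolderTriple 4 4 2 := ⟨by
    rw [show (4 : ENNReal) = 2 * 2 by norm_num, ENNReal.mul_inv (by simp) (by simp), ← mul_add,
      ENNReal.inv_two_add_inv_two, mul_one]⟩
  exact (memLp_coord v j).mul (memLp_coord v i)

lemma memLp_qq (v : ℝ) : MemLp qq 2 (gaussPrior n v) := by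
  unfold qq
  exact memLp_finsetSum _ fun i _ => by simpa only [sq] using memLp_coord_mul v i i

lemma memLp_yy_vec (v : ℝ) :
    MemLp (fun s : Fin n → ℝ => yy (vecMulVec s s)) 2 (gaussPrior n v) := by
  unfold yy
  exact memLp_finsetSum _ fun i _ => memLp_finsetSum _ fun j _ => (memLp_coord_mul v i j).abs

lemma memLp_yy_noise : MemLp yy 2 (noiseMeasure n) := by
  unfold yy
  refine memLp_finsetSum _ fun i _ => memLp_finsetSum _ fun j _ => MemLp.abs ?_
  unfold noiseMeasure
  rw [memLp_map_measure_iff (measurable_entry i j).aestronglyMeasurable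
    measurable_symm.aemeasurable]
  have h : ∀ p : Fin n × Fin n, MemLp (fun g : Fin n × Fin n → ℝ => g p) 2
      (Measure.pi fun p : Fin n × Fin n => gaussianReal 0 (if p.1 = p.2 then 2 else 1)) := fun p =>
    (memLp_id_gaussianReal' 2 (by norm_num)).comp_measurePreserving
      (measurePreserving_eval
        (fun p : Fin n × Fin n => gaussianReal 0 (if p.1 = p.2 then 2 else 1)) p)
  by_cases hij : i ≤ j
  · simpa [Function.comp_def, hij] using h (i, j)
  · simpa [Function.comp_def, hij] using h (j, i)

lemma trace_eq_bb (M : Matrix (Fin n) (Fin n) ℝ) (x : Fin n → ℝ) :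
    Matrix.trace (M * vecMulVec x x) = bb M x := by
  unfold bb Matrix.trace
  refine Finset.sum_congr rfl fun i _ => ?_
  rw [Matrix.diag_apply, Matrix.mul_apply]
  refine Finset.sum_congr rfl fun j _ => ?_
  rw [vecMulVec_apply]
  ring

lemma partitionFn_eq (sig' lam' : ℝ) (M : Matrix (Fin n) (Fin n) ℝ) :
    partitionFn n sig' lam' M = ∫ x, Real.exp
      (HH (lam' / (4 * n)) ((1 / 2) * Real.sqrt (lam' / n)) M x) ∂gaussPrior n (sig' ^ 2) := by
  unfold partitionFn
  simp only [trace_eq_bb]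
  rfl

lemma frobSq_sub_smul (k : ℝ) (M : Matrix (Fin n) (Fin n) ℝ) (x : Fin n → ℝ) :
    frobSq (M - k • vecMulVec x x) = frobSq M - 2 * k * bb M x + k ^ 2 * (qq x) ^ 2 := by
  have h : (qq x) ^ 2 = ∑ i, ∑ j, (x i) ^ 2 * (x j) ^ 2 := by
    rw [sq, qq, Finset.sum_mul_sum]
  rw [h]
  unfold frobSq bb
  simp only [Finset.mul_sum, ← Finset.sum_sub_distrib, ← Finset.sum_add_distrib]
  refine Finset.sum_congr rfl fun i _ => Finset.sum_congr rfl fun j _ => ?_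
  simp only [Matrix.sub_apply, Matrix.smul_apply, vecMulVec_apply, smul_eq_mul]
  ring

lemma weight_eq {lam' : ℝ} (hlam' : 0 < lam') (M : Matrix (Fin n) (Fin n) ℝ) (x : Fin n → ℝ) :
    weight n lam' M x = Real.exp (-(1 / 4) * frobSq M) *
      Real.exp (HH (lam' / (4 * n)) ((1 / 2) * Real.sqrt (lam' / n)) M x) := by
  unfold weight HH
  rw [frobSq_sub_smul, Real.sq_sqrt (by positivity), ← Real.exp_add]
  congr 1
  ring

lemma gibbs_eq {lam' : ℝ} (sig' : ℝ) (hlam' : 0 < lam') (M : Matrix (Fin n) (Fin n) ℝ)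
    (f : (Fin n → ℝ) → ℝ) :
    gibbs n sig' lam' M f =
      (∫ x, f x * Real.exp (HH (lam' / (4 * n)) ((1 / 2) * Real.sqrt (lam' / n)) M x)
        ∂gaussPrior n (sig' ^ 2)) /
      (∫ x, Real.exp (HH (lam' / (4 * n)) ((1 / 2) * Real.sqrt (lam' / n)) M x)
        ∂gaussPrior n (sig' ^ 2)) := by
  unfold gibbs
  simp only [weight_eq hlam', mul_left_comm (f _), integral_const_mul]
  exact mul_div_mul_left _ _ (Real.exp_pos _).ne'

end aux

/-- The derivative of the mismatched free energy with respect to the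
true SNR `λ`: `(d/dλ) f_n = −(1/4)(1/n²)√(λ'/λ) E[⟨(sᵀx)²⟩_{λ',σ'}]`. -/
theorem deriv_freeEnergy_trueSNR (n : ℕ) (hn : 1 ≤ n) (sig sig' lam lam' : ℝ)
    (hsig : 0 < sig) (hsig' : 0 < sig') (hlam : 0 < lam) (hlam' : 0 < lam') :
    deriv (fun t => freeEnergy n sig sig' t lam') lam =
      -(1 / 4) * (1 / (n : ℝ) ^ 2) * Real.sqrt (lam' / lam) *
        ∫ p, gibbs n sig' lam' (obs n lam p.1 p.2)
            (fun x => (∑ i, p.1 i * x i) ^ 2)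
          ∂((gaussPrior n (sig ^ 2)).prod (noiseMeasure n)) := by
  have hn0 : (0 : ℝ) < n := by exact_mod_cast hn
  have ha : 0 < lam' / (4 * n) := by positivity
  have hc : 0 ≤ (1 / 2) * Real.sqrt (lam' / n) := by positivity
  have key := hasDerivAt_logZ (gaussPrior n (sig' ^ 2)) ha hc (memLp_qq _)
    ((gaussPrior n (sig ^ 2)).prod (noiseMeasure n))
    ((memLp_yy_vec (sig ^ 2)).comp_fst _) (memLp_yy_noise.comp_snd _) (Real.sqrt (lam / n))
  have hs : HasDerivAt (fun t : ℝ => Real.sqrt (t / n))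
      (1 / n / (2 * Real.sqrt (lam / n))) lam :=
    ((hasDerivAt_id lam).div_const (n : ℝ)).sqrt (by simp only [id]; positivity)
  have h := (key.comp lam hs).const_mul (-(1 / (n : ℝ)))
  have hf : (fun t => freeEnergy n sig sig' t lam') = fun t => -(1 / (n : ℝ)) *
      ((fun t => ∫ p, Real.log (∫ x, Real.exp (HH (lam' / (4 * n))
        ((1 / 2) * Real.sqrt (lam' / n)) (t • vecMulVec p.1 p.1 + p.2) x)
          ∂gaussPrior n (sig' ^ 2)) ∂((gaussPrior n (sig ^ 2)).prod (noiseMeasure n))) ∘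
        fun t : ℝ => Real.sqrt (t / n)) t := by
    funext t
    unfold freeEnergy
    simp only [partitionFn_eq, obs, Function.comp]
  rw [hf, h.deriv]
  simp only [gibbs_eq sig' hlam', obs, bb_vecMulVec, mul_assoc ((1 / 2) * Real.sqrt (lam' / n)),
    integral_const_mul, mul_div_assoc]
  generalize (∫ p, _ ∂((gaussPrior n (sig ^ 2)).prod (noiseMeasure n)) : ℝ) = I
  rw [Real.sqrt_div hlam'.le, Real.sqrt_div hlam.le, Real.sqrt_div hlam'.le]
  have h1 := Real.sqrt_pos.2 hlam
  have h2 := Real.sqrt_pos.2 hn0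
  have h3 := Real.sqrt_pos.2 hlam'
  field_simp
  norm_num
  ring

end
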